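/- There exist absolute constants c > 0 and C > 0 such that for every finite set A ⊆ ℝ with |A| ≥ 2, writing S := A+A and assuming 0 ∉ S, one has |SS| ≥ c · |S|^(1 + 1/398) / (log |A|)^C; that is, the sum set grows under multiplication. -/

import Mathlib

open Finset Pointwise

/-! ### Collisions of a map and layer-cake sums -/

lemma sum_sq_card_fiber_eq_card_collisions {α β : Type*} [DecidableEq β] (s : Finset α)
    (t : Finset β) (f : α → β) (hf : ∀ a ∈ s, f a ∈ t) :
    ∑ b ∈ t, #{a ∈ s | f a = b} ^ 2 = #{p ∈ s ×ˢ s | f p.1 = f p.2} := by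
  rw [card_eq_sum_card_fiberwise (f := fun p : α × α => f p.1) (t := t)]
  · refine sum_congr rfl fun b _ => ?_
    rw [sq, ← card_product]
    congr 1
    ext ⟨x, y⟩
    simp only [mem_product, mem_filter]
    constructor
    · rintro ⟨⟨hx, rfl⟩, hy, h⟩
      exact ⟨⟨⟨hx, hy⟩, h.symm⟩, rfl⟩
    · rintro ⟨⟨⟨hx, hy⟩, h⟩, rfl⟩
      exact ⟨⟨hx, rfl⟩, hy, h.symm⟩
  · intro p hp
    simp only [mem_coe, mem_filter, mem_product] at hp
    exact hf _ hp.1.1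

lemma card_sq_le_card_mul_card_collisions {α β : Type*} [DecidableEq β] (s : Finset α)
    (t : Finset β) (f : α → β) (hf : ∀ a ∈ s, f a ∈ t) :
    #s ^ 2 ≤ #t * #{p ∈ s ×ˢ s | f p.1 = f p.2} := by
  rw [← sum_sq_card_fiber_eq_card_collisions s t f hf, card_eq_sum_card_fiberwise (t := t) hf]
  exact sq_sum_le_card_mul_sum_sq

/-- The harmonic sum `1 + 1/2 + ⋯ + 1/K`. -/
noncomputable def harmonicSum (K : ℕ) : ℝ := ∑ k ∈ Icc 1 K, (1 : ℝ) / k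

lemma one_le_harmonicSum {K : ℕ} (hK : 1 ≤ K) : 1 ≤ harmonicSum K := by
  have := single_le_sum (f := fun k : ℕ => (1 : ℝ) / k) (s := Icc 1 K)
    (fun k _ => by positivity) (mem_Icc.2 ⟨le_refl 1, hK⟩)
  simpa [harmonicSum] using this

lemma harmonicSum_le (K : ℕ) : harmonicSum K ≤ 1 + Real.log K := by
  refine le_trans (le_of_eq ?_) (harmonic_le_one_add_log K)
  simp [harmonicSum, harmonic_eq_sum_Icc]

lemma cube_le_sum_Icc (r : ℕ) : r ^ 3 ≤ ∑ k ∈ Icc 1 r, 3 * k ^ 2 := by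
  induction r with
  | zero => simp
  | succ n ih =>
    rw [sum_Icc_succ_top (by omega)]
    calc (n + 1) ^ 3 ≤ n ^ 3 + 3 * (n + 1) ^ 2 := by nlinarith [Nat.zero_le n]
      _ ≤ _ := by gcongr

lemma sq_le_sum_Icc (r : ℕ) : r ^ 2 ≤ ∑ k ∈ Icc 1 r, 2 * k := by
  induction r with
  | zero => simp
  | succ n ih =>
    rw [sum_Icc_succ_top (by omega)]
    calc (n + 1) ^ 2 ≤ n ^ 2 + 2 * (n + 1) := by nlinarith
      _ ≤ _ := by gcongr

/-- A function whose superlevel sets decay cubically has small third moment. -/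
lemma sum_cube_le_of_card_superlevel_le {α : Type*} (D : Finset α) (r : α → ℕ) (K : ℕ) (B : ℝ)
    (hr : ∀ d ∈ D, r d ≤ K)
    (hB : ∀ k ∈ Icc 1 K, (#{d ∈ D | k ≤ r d} : ℝ) * (k : ℝ) ^ 3 ≤ B) :
    ∑ d ∈ D, (r d : ℝ) ^ 3 ≤ 3 * B * harmonicSum K := by
  have h1 : ∀ d ∈ D, (r d : ℝ) ^ 3 ≤
      ∑ k ∈ Icc 1 K, if k ≤ r d then (3 * (k : ℝ) ^ 2) else 0 := by
    intro d hd
    rw [← sum_filter]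
    have : (Icc 1 K).filter (fun k => k ≤ r d) = Icc 1 (r d) := by
      ext k
      have := hr d hd
      simp only [mem_filter, mem_Icc]
      omega
    rw [this]
    exact_mod_cast cube_le_sum_Icc (r d)
  calc ∑ d ∈ D, (r d : ℝ) ^ 3
      ≤ ∑ d ∈ D, ∑ k ∈ Icc 1 K, if k ≤ r d then (3 * (k : ℝ) ^ 2) else 0 := sum_le_sum h1
    _ = ∑ k ∈ Icc 1 K, 3 * (k : ℝ) ^ 2 * #{d ∈ D | k ≤ r d} := by
        rw [sum_comm]
        refine sum_congr rfl fun k _ => ?_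
        rw [← sum_filter, sum_const, nsmul_eq_mul, mul_comm]
    _ ≤ ∑ k ∈ Icc 1 K, 3 * B * ((1 : ℝ) / k) := by
        refine sum_le_sum fun k hk => ?_
        have hk0 : (0 : ℝ) < k := by
          have := (mem_Icc.1 hk).1
          exact_mod_cast this
        rw [mul_one_div, le_div_iff₀ hk0]
        nlinarith [hB k hk]
    _ = 3 * B * harmonicSum K := by rw [harmonicSum, mul_sum]

/-! ### Rich lines in grids -/

/-- The index of the block of `x`, when `X` is cut into consecutive blocks of length `s`. -/
noncomputable def blockIndex (X : Finset ℝ) (s : ℕ) (x : ℝ) : ℕ := #{y ∈ X | y < x} / s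

lemma blockIndex_mono (X : Finset ℝ) (s : ℕ) : Monotone (blockIndex X s) := by
  intro x y hxy
  refine Nat.div_le_div_right (card_le_card fun z hz => ?_)
  simp only [mem_filter] at hz ⊢
  exact ⟨hz.1, hz.2.trans_le hxy⟩

lemma card_filter_lt_lt {X : Finset ℝ} {x y : ℝ} (hx : x ∈ X) (hxy : x < y) :
    #{z ∈ X | z < x} < #{z ∈ X | z < y} := by
  refine card_lt_card ⟨fun z hz => ?_, fun h => ?_⟩
  · simp only [mem_filter] at hz ⊢
    exact ⟨hz.1, hz.2.trans hxy⟩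
  · have := h (mem_filter.2 ⟨hx, hxy⟩)
    simp at this

lemma blockIndex_mul_lt {X : Finset ℝ} (s : ℕ) {x : ℝ} (hx : x ∈ X) :
    blockIndex X s x * s < #X := by
  refine (Nat.div_mul_le_self _ _).trans_lt (card_lt_card ⟨filter_subset _ _, fun h => ?_⟩)
  have := h hx
  simp at this

lemma card_blockIndex_eq_le (X : Finset ℝ) {s : ℕ} (hs : 0 < s) (j : ℕ) :
    #{x ∈ X | blockIndex X s x = j} ≤ s := by
  have : #{x ∈ X | blockIndex X s x = j} ≤ #(Ico (j * s) (j * s + s)) := by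
    refine card_le_card_of_injOn (fun x => #{z ∈ X | z < x}) ?_ ?_
    · intro x hx
      simp only [mem_coe, mem_filter] at hx
      simp only [coe_Ico, Set.mem_Ico]
      have := (Nat.div_eq_iff hs).1 hx.2
      omega
    · intro x hx y hy h
      simp only [mem_coe, mem_filter] at hx hy h
      rcases lt_trichotomy x y with h' | h' | h'
      · have := card_filter_lt_lt hx.1 h'
        omega
      · exact h'
      · have := card_filter_lt_lt hy.1 h'
        omega
  simpa using this

/-- The number of points of the grid `X × Y` on the line `y = l.1 * x + l.2`. -/
noncomputable def lineCount (X Y : Finset ℝ) (l : ℝ × ℝ) : ℕ := #{x ∈ X | l.1 * x + l.2 ∈ Y}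

lemma lineCount_le_left (X Y : Finset ℝ) (l : ℝ × ℝ) : lineCount X Y l ≤ #X :=
  card_filter_le _ _

lemma lineCount_le_right (X Y : Finset ℝ) {l : ℝ × ℝ} (hl : l.1 ≠ 0) : lineCount X Y l ≤ #Y := by
  refine card_le_card_of_injOn (fun x => l.1 * x + l.2) (fun x hx => ?_) fun x _ y _ h => ?_
  · simp only [mem_coe, mem_filter] at hx
    exact hx.2
  · simpa [hl] using h

lemma card_mul_cube_le_of_pos_slope (X Y : Finset ℝ) (L : Finset (ℝ × ℝ)) (k : ℕ) (hk : 2 ≤ k)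
    (hL : ∀ l ∈ L, 0 < l.1) (hrich : ∀ l ∈ L, k ≤ lineCount X Y l) :
    #L * k ^ 3 ≤ 243 * (#X ^ 2 * #Y ^ 2) := by
  rcases L.eq_empty_or_nonempty with rfl | ⟨l₀, hl₀⟩
  · simp
  have hkX : k ≤ #X := (hrich _ hl₀).trans (lineCount_le_left _ _ _)
  have hkY : k ≤ #Y := (hrich _ hl₀).trans (lineCount_le_right _ _ (hL _ hl₀).ne')
  set s := 8 * #X / k + 1 with hs
  set t := 8 * #Y / k + 1 with ht
  have hsk : s * k ≤ 9 * #X := by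
    have := Nat.div_mul_le_self (8 * #X) k
    rw [hs, add_mul]
    omega
  have htk : t * k ≤ 9 * #Y := by
    have := Nat.div_mul_le_self (8 * #Y) k
    rw [ht, add_mul]
    omega
  have hsk' : 8 * #X < s * k := by
    have := Nat.div_add_mod (8 * #X) k
    have := Nat.mod_lt (8 * #X) (by omega : k > 0)
    rw [hs, add_mul, mul_comm _ k]
    omega
  have htk' : 8 * #Y < t * k := by
    have := Nat.div_add_mod (8 * #Y) k
    have := Nat.mod_lt (8 * #Y) (by omega : k > 0)
    rw [ht, add_mul, mul_comm _ k]
    omega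
  have hs0 : 0 < s := Nat.succ_pos _
  have ht0 : 0 < t := Nat.succ_pos _
  let i := blockIndex X s
  let j := blockIndex Y t
  have hi : ∀ x ∈ X, 8 * i x < k := fun x hx => by
    have := blockIndex_mul_lt s hx
    by_contra! h
    have : k * s ≤ 8 * i x * s := Nat.mul_le_mul_right _ h
    simp only [i] at this
    nlinarith
  have hj : ∀ y ∈ Y, 8 * j y < k := fun x hx => by
    have := blockIndex_mul_lt t hx
    by_contra! h
    have : k * t ≤ 8 * j x * t := Nat.mul_le_mul_right _ h
    simp only [j] at this
    nlinarith
  let P : ℝ × ℝ → Finset (ℝ × ℝ) := fun l =>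
    {p ∈ ({x ∈ X | l.1 * x + l.2 ∈ Y} ×ˢ {x ∈ X | l.1 * x + l.2 ∈ Y}).filter
      (fun p => i p.1 + j (l.1 * p.1 + l.2) = i p.2 + j (l.1 * p.2 + l.2)) | p.1 ≠ p.2}
  have hP : ∀ l ∈ L, k ≤ 3 * #(P l) := by
    intro l hl
    have hc := hrich l hl
    unfold lineCount at hc
    have h1 := card_sq_le_card_mul_card_collisions {x ∈ X | l.1 * x + l.2 ∈ Y}
      (range ((k - 1) / 4 + 1)) (fun x => i x + j (l.1 * x + l.2)) (by
        intro x hx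
        have hx := mem_filter.1 hx
        have := hi _ hx.1
        have := hj _ hx.2
        simp only [mem_range]
        omega)
    rw [card_range, ← card_filter_add_card_filter_not (fun p : ℝ × ℝ => p.1 ≠ p.2)] at h1
    set c := #{x ∈ X | l.1 * x + l.2 ∈ Y} with hcdef
    have h2 : #{p ∈ ({x ∈ X | l.1 * x + l.2 ∈ Y} ×ˢ {x ∈ X | l.1 * x + l.2 ∈ Y}).filter
        (fun p => i p.1 + j (l.1 * p.1 + l.2) = i p.2 + j (l.1 * p.2 + l.2)) | ¬ p.1 ≠ p.2} ≤ c := by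
      refine card_le_card_of_injOn Prod.fst (fun p hp => ?_) (fun p hp q hq h => ?_)
      · simp only [mem_coe, mem_filter, mem_product] at hp ⊢
        exact hp.1.1.1
      · simp only [mem_coe, mem_filter, not_not] at hp hq
        exact Prod.ext h (by rw [← hp.2, ← hq.2, h])
    have h3 : c ^ 2 ≤ ((k - 1) / 4 + 1) * (#(P l) + c) :=
      h1.trans (Nat.mul_le_mul_left _ (Nat.add_le_add_left h2 _))
    have h4 : 4 * ((k - 1) / 4 + 1) ≤ 3 * c := by omega
    have h5 : 4 * c * c ≤ 3 * (#(P l) + c) * c := by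
      calc 4 * c * c = 4 * c ^ 2 := by ring
        _ ≤ 4 * (((k - 1) / 4 + 1) * (#(P l) + c)) := by gcongr
        _ = 4 * ((k - 1) / 4 + 1) * (#(P l) + c) := by ring
        _ ≤ 3 * c * (#(P l) + c) := by gcongr
        _ = _ := by ring
    have := Nat.le_of_mul_le_mul_right h5 (by omega : 0 < c)
    omega
  let G : Finset ((ℝ × ℝ) × (ℝ × ℝ)) :=
    (X ×ˢ Y).sigma (fun p => {x ∈ X | i x = i p.1} ×ˢ {y ∈ Y | j y = j p.2}) |>.image
      fun q => (q.1, q.2)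
  have hG : #G ≤ #X * #Y * (s * t) := by
    refine card_image_le.trans ?_
    rw [card_sigma, ← card_product]
    refine (sum_le_card_nsmul _ _ (s * t) fun p _ => ?_).trans (by simp)
    rw [card_product]
    exact Nat.mul_le_mul (card_blockIndex_eq_le X hs0 _) (card_blockIndex_eq_le Y ht0 _)
  have hLG : ∑ l ∈ L, #(P l) ≤ #G := by
    rw [← card_sigma]
    refine card_le_card_of_injOn
      (fun q => ((q.2.1, q.1.1 * q.2.1 + q.1.2), (q.2.2, q.1.1 * q.2.2 + q.1.2))) ?_ ?_
    · rintro ⟨l, x, x'⟩ hq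
      simp only [P, mem_coe, mem_sigma, mem_filter, mem_product] at hq
      obtain ⟨hl, ⟨⟨⟨hx, hy⟩, hx', hy'⟩, hij⟩, hne⟩ := hq
      have key : i x = i x' ∧ j (l.1 * x + l.2) = j (l.1 * x' + l.2) := by
        have hpos := hL l hl
        rcases le_total x x' with h | h
        · have h1 : i x ≤ i x' := blockIndex_mono _ _ h
          have h2 : j (l.1 * x + l.2) ≤ j (l.1 * x' + l.2) :=
            blockIndex_mono _ _ (by gcongr)
          omega
        · have h1 : i x' ≤ i x := blockIndex_mono _ _ h
          have h2 : j (l.1 * x' + l.2) ≤ j (l.1 * x + l.2) :=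
            blockIndex_mono _ _ (by gcongr)
          omega
      simp only [G, mem_coe, mem_image, mem_sigma, mem_product, mem_filter]
      exact ⟨⟨(x, l.1 * x + l.2), (x', l.1 * x' + l.2)⟩,
        ⟨⟨hx, hy⟩, ⟨hx', key.1.symm⟩, hy', key.2.symm⟩, rfl⟩
    · rintro ⟨l, x, x'⟩ hq ⟨m, z, z'⟩ hq' h
      simp only [P, mem_coe, mem_sigma, mem_filter] at hq
      simp only [Prod.mk.injEq] at h
      obtain ⟨⟨rfl, h1⟩, rfl, h2⟩ := h
      have hne : x - x' ≠ 0 := sub_ne_zero.2 hq.2.2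
      have hs : l.1 = m.1 := mul_right_cancel₀ hne (by linarith)
      have hi : l.2 = m.2 := by rw [hs] at h1; linarith
      rw [Prod.ext hs hi]
  have h6 : #L * k ≤ 3 * (#X * #Y * (s * t)) := by
    calc #L * k = ∑ l ∈ L, k := by simp
      _ ≤ ∑ l ∈ L, 3 * #(P l) := sum_le_sum hP
      _ = 3 * ∑ l ∈ L, #(P l) := by rw [mul_sum]
      _ ≤ _ := Nat.mul_le_mul_left _ (hLG.trans hG)
  calc #L * k ^ 3 = (#L * k) * k ^ 2 := by ring
    _ ≤ 3 * (#X * #Y * (s * t)) * k ^ 2 := Nat.mul_le_mul_right _ h6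
    _ = 3 * (#X * #Y) * ((s * k) * (t * k)) := by ring
    _ ≤ 3 * (#X * #Y) * ((9 * #X) * (9 * #Y)) := by gcongr
    _ = _ := by ring

/-- The Szemerédi–Trotter bound for the number of rich lines in a Cartesian product. -/
lemma card_mul_cube_le_of_rich (X Y : Finset ℝ) (L : Finset (ℝ × ℝ)) (k : ℕ) (hk : 2 ≤ k)
    (hL : ∀ l ∈ L, l.1 ≠ 0) (hrich : ∀ l ∈ L, k ≤ lineCount X Y l) :
    #L * k ^ 3 ≤ 486 * (#X ^ 2 * #Y ^ 2) := by
  have h1 := card_mul_cube_le_of_pos_slope X Y {l ∈ L | 0 < l.1} k hk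
    (fun l hl => (mem_filter.1 hl).2) (fun l hl => hrich l (mem_filter.1 hl).1)
  have h2 := card_mul_cube_le_of_pos_slope X (-Y) (-{l ∈ L | ¬ 0 < l.1}) k hk
    (fun l hl => by
      have := mem_filter.1 (mem_neg'.1 hl)
      have h0 := hL _ this.1
      have h1 := this.2
      simp only [Prod.fst_neg, Left.neg_pos_iff, not_lt, ne_eq, neg_eq_zero] at h0 h1
      exact lt_of_le_of_ne (by linarith) (Ne.symm h0))
    (fun l hl => by
      refine (hrich _ (mem_filter.1 (mem_neg'.1 hl)).1).trans (le_of_eq ?_)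
      unfold lineCount
      congr 1
      ext x
      simp only [mem_filter, mem_neg', Prod.fst_neg, Prod.snd_neg]
      rw [show -l.1 * x + -l.2 = -(l.1 * x + l.2) by ring])
  rw [card_neg, card_neg] at h2
  rw [← card_filter_add_card_filter_not (s := L) (fun l : ℝ × ℝ => 0 < l.1), add_mul]
  omega

/-- The third moment of the number of points on lines meeting a grid at least twice. -/
lemma sum_lineCount_cube_le (X Y : Finset ℝ) (L : Finset (ℝ × ℝ)) (K : ℕ) (hK : #X ≤ K)
    (hL : ∀ l ∈ L, l.1 ≠ 0) (hrich : ∀ l ∈ L, 2 ≤ lineCount X Y l) :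
    ∑ l ∈ L, (lineCount X Y l : ℝ) ^ 3 ≤ 1458 * ((#X : ℝ) ^ 2 * (#Y : ℝ) ^ 2) * harmonicSum K := by
  refine (sum_cube_le_of_card_superlevel_le L (lineCount X Y) K (486 * (#X ^ 2 * #Y ^ 2))
    (fun l _ => (lineCount_le_left _ _ _).trans hK) fun k hk => ?_).trans (le_of_eq (by ring))
  have hk := (mem_Icc.1 hk).1
  rcases hk.eq_or_lt with rfl | hk
  · have := card_mul_cube_le_of_rich X Y L 2 le_rfl hL hrich
    have h' : #{d ∈ L | 1 ≤ lineCount X Y d} ≤ #L := card_filter_le _ _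
    have h'' : #{d ∈ L | 1 ≤ lineCount X Y d} * 1 ^ 3 ≤ 486 * (#X ^ 2 * #Y ^ 2) := by omega
    exact_mod_cast h''
  · have := card_mul_cube_le_of_rich X Y {d ∈ L | k ≤ lineCount X Y d} k hk
      (fun l hl => hL l (mem_filter.1 hl).1) (fun l hl => (mem_filter.1 hl).2)
    exact_mod_cast this

/-- The Szemerédi–Trotter incidence bound in a Cartesian product, with a logarithmic loss. -/
lemma sum_lineCount_pow_three_le (X Y : Finset ℝ) (L : Finset (ℝ × ℝ)) (K : ℕ) (hK : #X ≤ K)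
    (hK1 : 1 ≤ K) (hL : ∀ l ∈ L, l.1 ≠ 0) (hLXY : #L ≤ #X ^ 2 * #Y ^ 2) :
    (∑ l ∈ L, (lineCount X Y l : ℝ)) ^ 3 ≤
      6000 * ((#X : ℝ) ^ 2 * (#Y : ℝ) ^ 2) * (#L : ℝ) ^ 2 * harmonicSum K := by
  set Z : ℝ := (#X : ℝ) ^ 2 * (#Y : ℝ) ^ 2 with hZ
  set L' := {l ∈ L | 2 ≤ lineCount X Y l} with hL'
  set I : ℝ := ∑ l ∈ L', (lineCount X Y l : ℝ) with hI
  have hI0 : 0 ≤ I := by positivity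
  have hH := one_le_harmonicSum hK1
  have h1 : ∑ l ∈ L, (lineCount X Y l : ℝ) ≤ #L + I := by
    rw [← sum_filter_add_sum_filter_not L (fun l => 2 ≤ lineCount X Y l), add_comm]
    gcongr
    calc ∑ l ∈ L with ¬ 2 ≤ lineCount X Y l, (lineCount X Y l : ℝ)
        ≤ ∑ l ∈ L with ¬ 2 ≤ lineCount X Y l, (1 : ℝ) := by
          refine sum_le_sum fun l hl => ?_
          have := (mem_filter.1 hl).2
          exact_mod_cast (by omega : lineCount X Y l ≤ 1)
      _ ≤ #L := by
          rw [sum_const, nsmul_eq_mul, mul_one]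
          exact_mod_cast card_filter_le _ _
  have h2 := sum_lineCount_cube_le X Y L' K hK (fun l hl => hL l (mem_filter.1 hl).1)
    (fun l hl => (mem_filter.1 hl).2)
  have h3 : I ^ 3 ≤ (#L : ℝ) ^ 2 * (1458 * Z * harmonicSum K) := by
    have hLL : (#L' : ℝ) ≤ #L := by exact_mod_cast card_filter_le _ _
    rcases L'.eq_empty_or_nonempty with h | h
    · have : I = 0 := by rw [hI, h, sum_empty]
      rw [this, zero_pow three_ne_zero]
      have := zero_le_one.trans hH
      positivity
    · have hc : (0 : ℝ) < #L' := by exact_mod_cast h.card_pos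
      have := pow_sum_div_card_le_sum_pow (s := L') (f := fun l => (lineCount X Y l : ℝ))
        (fun _ _ => by positivity) 2
      rw [div_le_iff₀ (by positivity)] at this
      calc I ^ 3 ≤ (∑ l ∈ L', (lineCount X Y l : ℝ) ^ 3) * (#L' : ℝ) ^ 2 := this
        _ ≤ (1458 * Z * harmonicSum K) * (#L : ℝ) ^ 2 := by gcongr
        _ = _ := by ring
  have h4 : (#L : ℝ) ≤ Z := by rw [hZ]; exact_mod_cast hLXY
  have hZ0 : 0 ≤ Z := by positivity
  calc (∑ l ∈ L, (lineCount X Y l : ℝ)) ^ 3 ≤ (#L + I) ^ 3 := by gcongr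
    _ ≤ 4 * ((#L : ℝ) ^ 3 + I ^ 3) := by
        have : (0 : ℝ) ≤ #L := by positivity
        nlinarith [mul_nonneg (add_nonneg this hI0) (sq_nonneg ((#L : ℝ) - I))]
    _ ≤ 4 * (Z * (#L : ℝ) ^ 2 * harmonicSum K + (#L : ℝ) ^ 2 * (1458 * Z * harmonicSum K)) := by
        gcongr
        calc (#L : ℝ) ^ 3 = #L * (#L : ℝ) ^ 2 * 1 := by ring
          _ ≤ Z * (#L : ℝ) ^ 2 * harmonicSum K := by gcongr
    _ = 5836 * (Z * (#L : ℝ) ^ 2 * harmonicSum K) := by ring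
    _ ≤ 6000 * (Z * (#L : ℝ) ^ 2 * harmonicSum K) := by
        gcongr; norm_num
    _ = _ := by ring

/-! ### Representations of differences -/

/-- The number of representations of `d` as a difference of two elements of `X`. -/
noncomputable def diffRep (X : Finset ℝ) (d : ℝ) : ℕ := #{x ∈ X | x - d ∈ X}

lemma diffRep_le (X : Finset ℝ) (d : ℝ) : diffRep X d ≤ #X := card_filter_le _ _

lemma diffRep_zero (X : Finset ℝ) : diffRep X 0 = #X := by
  simp [diffRep]

lemma diffRep_neg (X : Finset ℝ) (d : ℝ) : diffRep X (-d) = diffRep X d := by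
  have key : ∀ e : ℝ, diffRep X e ≤ diffRep X (-e) := fun e => by
    refine card_le_card_of_injOn (fun x => x - e) (fun x hx => ?_) (fun x _ y _ h => ?_)
    · simp only [mem_coe, mem_filter] at hx ⊢
      simpa using hx.symm
    · simpa using h
  exact le_antisymm (by simpa using key (-d)) (key d)

lemma mem_sub_of_diffRep_pos {X : Finset ℝ} {d : ℝ} (h : 1 ≤ diffRep X d) : d ∈ X - X := by
  obtain ⟨x, hx⟩ := card_pos.1 h
  have hx := mem_filter.1 hx
  exact mem_sub.2 ⟨x, hx.1, x - d, hx.2, by ring⟩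

/-- The differences with at least `k` representations. -/
noncomputable def popularDiffs (X : Finset ℝ) (k : ℕ) : Finset ℝ := {d ∈ X - X | k ≤ diffRep X d}

lemma mul_mem_popularDiffs {S X : Finset ℝ} (hS : (0 : ℝ) ∉ S) {k : ℕ} (hk : 1 ≤ k) {s d : ℝ}
    (hs : s ∈ S) (hd : d ∈ popularDiffs X k) : s * d ∈ popularDiffs (S * X) k := by
  have hs0 : s ≠ 0 := fun h => hS (h ▸ hs)
  have h : k ≤ diffRep (S * X) (s * d) := by
    refine (mem_filter.1 hd).2.trans
      (card_le_card_of_injOn (fun x => s * x) (fun x hx => ?_) (fun x _ y _ h => ?_))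
    · simp only [mem_coe, mem_filter] at hx ⊢
      refine ⟨mul_mem_mul hs hx.1, ?_⟩
      rw [← mul_sub]
      exact mul_mem_mul hs hx.2
    · simpa [hs0] using h
  exact mem_filter.2 ⟨mem_sub_of_diffRep_pos (hk.trans h), h⟩

lemma card_le_card_mul_of_mem_ne_zero {S X : Finset ℝ} {x : ℝ} (hx : x ∈ X) (hx0 : x ≠ 0) :
    #S ≤ #(S * X) :=
  card_le_card_of_injOn (fun s => s * x) (fun _ hs => mul_mem_mul hs hx)
    (fun s _ t _ h => by simpa [hx0] using h)

lemma card_popularDiffs_mul_le {S X : Finset ℝ} (hS : (0 : ℝ) ∉ S) (hX : (0 : ℝ) ∉ X) {k : ℕ}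
    (hk : 1 ≤ k) : #S * #(popularDiffs X k) * k ^ 3 ≤ 486 * (#X ^ 2 * #(S * X) ^ 2) := by
  rcases X.eq_empty_or_nonempty with rfl | ⟨x₀, hx₀⟩
  · simp [popularDiffs]
  rcases hk.eq_or_lt with rfl | hk
  · have h1 : #(popularDiffs X 1) ≤ #X ^ 2 := by
      refine (card_filter_le _ _).trans ?_
      rw [sq]
      exact card_sub_le
    have h2 : #S ≤ #(S * X) := card_le_card_mul_of_mem_ne_zero hx₀ fun h => hX (h ▸ hx₀)
    calc #S * #(popularDiffs X 1) * 1 ^ 3 ≤ #(S * X) * #X ^ 2 := by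
          rw [one_pow, mul_one]; gcongr
      _ ≤ #(S * X) ^ 2 * #X ^ 2 := by gcongr; exact Nat.le_self_pow two_ne_zero _
      _ ≤ _ := by rw [mul_comm (#(S * X) ^ 2)]; omega
  · have hinj : Set.InjOn (fun p : ℝ × ℝ => (p.1, -(p.1 * p.2))) ↑(S ×ˢ popularDiffs X k) := by
      rintro ⟨s, d⟩ hp ⟨s', d'⟩ _ h
      simp only [coe_product, Set.mem_prod, mem_coe] at hp
      simp only [Prod.mk.injEq, neg_inj] at h
      obtain ⟨rfl, h⟩ := h
      have hs0 : s ≠ 0 := fun h => hS (h ▸ hp.1)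
      simpa [hs0] using h
    rw [← card_product, ← card_image_of_injOn hinj]
    refine card_mul_cube_le_of_rich X (S * X) _ k hk (fun l hl => ?_) (fun l hl => ?_)
    · obtain ⟨⟨s, d⟩, hp, rfl⟩ := mem_image.1 hl
      exact fun h => hS (h ▸ (mem_product.1 hp).1)
    · obtain ⟨⟨s, d⟩, hp, rfl⟩ := mem_image.1 hl
      obtain ⟨hs, hd⟩ := mem_product.1 hp
      refine (mem_filter.1 hd).2.trans (card_le_card fun x hx => ?_)
      simp only [mem_filter] at hx ⊢
      refine ⟨hx.1, ?_⟩
      rw [show s * x + -(s * d) = s * (x - d) by ring]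
      exact mul_mem_mul hs hx.2

/-- The third moment of the number of representations of differences. -/
noncomputable def thirdEnergy (X : Finset ℝ) : ℝ := ∑ d ∈ X - X, (diffRep X d : ℝ) ^ 3

lemma card_mul_thirdEnergy_le {S X : Finset ℝ} (hS : (0 : ℝ) ∉ S) (hX : (0 : ℝ) ∉ X) {K : ℕ}
    (hK : #X ≤ K) :
    #S * thirdEnergy X ≤ 1458 * ((#X : ℝ) ^ 2 * (#(S * X) : ℝ) ^ 2) * harmonicSum K := by
  rcases S.eq_empty_or_nonempty with rfl | hS'
  · simp
  have hN : (0 : ℝ) < #S := by exact_mod_cast hS'.card_pos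
  have := sum_cube_le_of_card_superlevel_le (X - X) (diffRep X) K
    (486 * ((#X : ℝ) ^ 2 * (#(S * X) : ℝ) ^ 2) / #S) (fun d _ => (diffRep_le X d).trans hK)
    (fun k hk => by
      rw [le_div_iff₀ hN]
      have h := card_popularDiffs_mul_le hS hX (mem_Icc.1 hk).1
      have h' : (#S * #(popularDiffs X k) * k ^ 3 : ℝ) ≤
        486 * ((#X : ℝ) ^ 2 * (#(S * X) : ℝ) ^ 2) := by exact_mod_cast h
      refine le_trans (le_of_eq ?_) h'
      rw [popularDiffs]
      ring)
  rw [thirdEnergy]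
  calc _ ≤ #S * (3 * (486 * ((#X : ℝ) ^ 2 * (#(S * X) : ℝ) ^ 2) / #S) * harmonicSum K) := by gcongr
    _ = _ := by field_simp; ring

/-! ### Triangles of popular differences -/

lemma card_mul_cube_triangles_le_of_card_le {S R₁ R₂ R₃ R : Finset ℝ} (hS : (0 : ℝ) ∉ S)
    (hR₁ : (0 : ℝ) ∉ R₁) (hR : ∀ s ∈ S, ∀ d ∈ R₁, s * d ∈ R) {K : ℕ} (hK : #R ≤ K) (hK1 : 1 ≤ K)
    (hcard : #R₃ ≤ #R₂) :
    #S * (#{p ∈ R₁ ×ˢ R₂ | p.1 - p.2 ∈ R₃} : ℝ) ^ 3 ≤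
      6000 * ((#R : ℝ) * #R₂ * #R₃) ^ 2 * harmonicSum K := by
  have hH := one_le_harmonicSum hK1
  rcases R₁.eq_empty_or_nonempty with rfl | ⟨d₀, hd₀⟩
  · simp only [empty_product, filter_empty, card_empty, Nat.cast_zero]
    rw [zero_pow three_ne_zero, mul_zero]
    have := zero_le_one.trans hH
    positivity
  rcases S.eq_empty_or_nonempty with rfl | hS'
  · simp only [card_empty, Nat.cast_zero, zero_mul]
    have := zero_le_one.trans hH
    positivity
  have hN : (0 : ℝ) < #S := by exact_mod_cast hS'.card_pos
  have hd₀0 : d₀ ≠ 0 := fun h => hR₁ (h ▸ hd₀)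
  have hSR : #S ≤ #R := card_le_card_of_injOn (fun s => s * d₀) (fun s hs => hR s hs d₀ hd₀)
    (fun s _ t _ h => by simpa [hd₀0] using h)
  set t := #{p ∈ R₁ ×ˢ R₂ | p.1 - p.2 ∈ R₃} with ht
  let L := (S ×ˢ R₃).image fun p : ℝ × ℝ => (p.1⁻¹, -p.2)
  have hL : #L = #S * #R₃ := by
    rw [← card_product]
    refine card_image_of_injective _ fun p q h => ?_
    simpa [Prod.ext_iff] using h
  have hL0 : ∀ l ∈ L, l.1 ≠ 0 := by
    intro l hl
    obtain ⟨p, hp, rfl⟩ := mem_image.1 hl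
    exact inv_ne_zero fun h => hS (h ▸ (mem_product.1 hp).1)
  have hLe : #L ≤ #R ^ 2 * #R₂ ^ 2 := by
    rw [hL, ← mul_pow]
    exact (Nat.mul_le_mul hSR hcard).trans (Nat.le_self_pow two_ne_zero _)
  have h1 := sum_lineCount_pow_three_le R R₂ L K hK hK1 hL0 hLe
  have h2 : #S * t ≤ ∑ l ∈ L, lineCount R R₂ l := by
    simp only [lineCount]
    rw [ht, ← card_product, ← card_sigma]
    refine card_le_card_of_injOn
      (fun q => (⟨(q.1⁻¹, -(q.2.1 - q.2.2)), q.1 * q.2.1⟩ : Σ _ : ℝ × ℝ, ℝ)) ?_ ?_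
    · rintro ⟨s, a, b⟩ hq
      simp only [mem_coe, mem_product, mem_filter] at hq
      obtain ⟨hs, ⟨ha, hb⟩, hab⟩ := hq
      have hs0 : s ≠ 0 := fun h => hS (h ▸ hs)
      simp only [mem_coe, mem_sigma, mem_filter]
      refine ⟨mem_image.2 ⟨(s, a - b), mem_product.2 ⟨hs, hab⟩, rfl⟩, hR s hs a ha, ?_⟩
      rw [inv_mul_cancel_left₀ hs0]
      simpa using hb
    · rintro ⟨s, a, b⟩ hq ⟨s', a', b'⟩ _ h
      simp only [mem_coe, mem_product, mem_filter] at hq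
      have hs0 : s ≠ 0 := fun h => hS (h ▸ hq.1)
      simp only [Sigma.mk.injEq, Prod.mk.injEq, inv_inj, heq_eq_eq, neg_inj] at h
      obtain ⟨⟨rfl, h1⟩, h2⟩ := h
      have h3 : a = a' := mul_left_cancel₀ hs0 h2
      subst h3
      simpa using h1
  have h3 : (#S * t : ℝ) ≤ ∑ l ∈ L, (lineCount R R₂ l : ℝ) := by exact_mod_cast h2
  have h4 : (#S * t : ℝ) ^ 3 ≤
      6000 * ((#R : ℝ) ^ 2 * (#R₂ : ℝ) ^ 2) * (#S * #R₃ : ℝ) ^ 2 * harmonicSum K := by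
    refine (pow_le_pow_left₀ (by positivity) h3 3).trans (h1.trans (le_of_eq ?_))
    rw [hL]
    push_cast
    ring
  refine le_of_mul_le_mul_left ?_ (by positivity : (0 : ℝ) < (#S : ℝ) ^ 2)
  calc (#S : ℝ) ^ 2 * (#S * (t : ℝ) ^ 3) = (#S * t : ℝ) ^ 3 := by ring
    _ ≤ _ := h4
    _ = _ := by ring

lemma card_mul_cube_triangles_le {S R₁ R₂ R₃ R : Finset ℝ} (hS : (0 : ℝ) ∉ S)
    (hR₁ : (0 : ℝ) ∉ R₁) (hR : ∀ s ∈ S, ∀ d ∈ R₁, s * d ∈ R) {K : ℕ} (hK : #R ≤ K)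
    (hK1 : 1 ≤ K) :
    #S * (#{p ∈ R₁ ×ˢ R₂ | p.1 - p.2 ∈ R₃} : ℝ) ^ 3 ≤
      6000 * ((#R : ℝ) * #R₂ * #R₃) ^ 2 * harmonicSum K := by
  rcases le_total #R₃ #R₂ with h | h
  · exact card_mul_cube_triangles_le_of_card_le hS hR₁ hR hK hK1 h
  · have hswap : #{p ∈ R₁ ×ˢ R₂ | p.1 - p.2 ∈ R₃} = #{p ∈ R₁ ×ˢ R₃ | p.1 - p.2 ∈ R₂} := by
      refine card_nbij' (fun p => (p.1, p.1 - p.2)) (fun p => (p.1, p.1 - p.2)) ?_ ?_ ?_ ?_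
      · intro p hp
        simp only [mem_coe, mem_filter, mem_product] at hp ⊢
        simp only [sub_sub_cancel]
        tauto
      · intro p hp
        simp only [mem_coe, mem_filter, mem_product] at hp ⊢
        simp only [sub_sub_cancel]
        tauto
      · intro p _
        simp
      · intro p _
        simp
    rw [hswap, mul_right_comm (#R : ℝ)]
    exact card_mul_cube_triangles_le_of_card_le hS hR₁ hR hK hK1 h

/-- Layer-cake bound for a weighted count of triangles. -/
lemma sum_sq_mul_sq_mul_sq_le (P : Finset (ℝ × ℝ)) (r : ℝ → ℕ) (K : ℕ) (B : ℝ)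
    (hr : ∀ d, r d ≤ K)
    (hB : ∀ k₁ ∈ Icc 1 K, ∀ k₂ ∈ Icc 1 K, ∀ k₃ ∈ Icc 1 K,
      (#{p ∈ P | k₁ ≤ r p.1 ∧ k₂ ≤ r p.2 ∧ k₃ ≤ r (p.1 - p.2)} : ℝ) *
        ((k₁ : ℝ) * k₂ * k₃) ^ 2 ≤ B) :
    ∑ p ∈ P, ((r p.1 : ℝ) * r p.2 * r (p.1 - p.2)) ^ 2 ≤ 8 * B * harmonicSum K ^ 3 := by
  have h1 : ∀ d, (r d : ℝ) ^ 2 ≤ ∑ k ∈ Icc 1 K, if k ≤ r d then (2 * (k : ℝ)) else 0 := by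
    intro d
    rw [← sum_filter]
    have : (Icc 1 K).filter (fun k => k ≤ r d) = Icc 1 (r d) := by
      ext k
      have := hr d
      simp only [mem_filter, mem_Icc]
      omega
    rw [this]
    exact_mod_cast sq_le_sum_Icc (r d)
  have h2 : ∀ p : ℝ × ℝ, ((r p.1 : ℝ) * r p.2 * r (p.1 - p.2)) ^ 2 ≤
      ∑ k₁ ∈ Icc 1 K, ∑ k₂ ∈ Icc 1 K, ∑ k₃ ∈ Icc 1 K,
        if k₁ ≤ r p.1 ∧ k₂ ≤ r p.2 ∧ k₃ ≤ r (p.1 - p.2) then 8 * ((k₁ : ℝ) * k₂ * k₃) else 0 := by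
    intro p
    rw [mul_pow, mul_pow]
    refine (mul_le_mul (mul_le_mul (h1 p.1) (h1 p.2) (by positivity)
      ((sq_nonneg _).trans (h1 p.1))) (h1 (p.1 - p.2)) (by positivity)
      (mul_nonneg ((sq_nonneg _).trans (h1 p.1)) ((sq_nonneg _).trans (h1 p.2)))).trans
      (le_of_eq ?_)
    rw [sum_mul_sum, sum_mul]
    refine sum_congr rfl fun k₁ _ => ?_
    rw [sum_mul_sum]
    refine sum_congr rfl fun k₂ _ => sum_congr rfl fun k₃ _ => ?_
    by_cases a : k₁ ≤ r p.1 <;> by_cases b : k₂ ≤ r p.2 <;> by_cases c : k₃ ≤ r (p.1 - p.2) <;>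
      simp [a, b, c]
    ring
  calc ∑ p ∈ P, ((r p.1 : ℝ) * r p.2 * r (p.1 - p.2)) ^ 2
      ≤ ∑ p ∈ P, ∑ k₁ ∈ Icc 1 K, ∑ k₂ ∈ Icc 1 K, ∑ k₃ ∈ Icc 1 K,
        if k₁ ≤ r p.1 ∧ k₂ ≤ r p.2 ∧ k₃ ≤ r (p.1 - p.2) then 8 * ((k₁ : ℝ) * k₂ * k₃) else 0 :=
        sum_le_sum fun p _ => h2 p
    _ = ∑ k₁ ∈ Icc 1 K, ∑ k₂ ∈ Icc 1 K, ∑ k₃ ∈ Icc 1 K, ∑ p ∈ P,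
        if k₁ ≤ r p.1 ∧ k₂ ≤ r p.2 ∧ k₃ ≤ r (p.1 - p.2) then 8 * ((k₁ : ℝ) * k₂ * k₃) else 0 := by
        rw [sum_comm]
        refine sum_congr rfl fun k₁ _ => ?_
        rw [sum_comm]
        refine sum_congr rfl fun k₂ _ => ?_
        rw [sum_comm]
    _ ≤ ∑ k₁ ∈ Icc 1 K, ∑ k₂ ∈ Icc 1 K, ∑ k₃ ∈ Icc 1 K,
        8 * B * ((1 : ℝ) / k₁ * (1 / k₂) * (1 / k₃)) := by
        refine sum_le_sum fun k₁ h₁ => sum_le_sum fun k₂ h₂ => sum_le_sum fun k₃ h₃ => ?_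
        have hB' := hB k₁ h₁ k₂ h₂ k₃ h₃
        have p₁ : (0 : ℝ) < k₁ := by exact_mod_cast (mem_Icc.1 h₁).1
        have p₂ : (0 : ℝ) < k₂ := by exact_mod_cast (mem_Icc.1 h₂).1
        have p₃ : (0 : ℝ) < k₃ := by exact_mod_cast (mem_Icc.1 h₃).1
        rw [← sum_filter, sum_const, nsmul_eq_mul,
          show 8 * B * ((1 : ℝ) / k₁ * (1 / k₂) * (1 / k₃)) = 8 * B / (k₁ * k₂ * k₃) by field_simp,
          le_div_iff₀ (by positivity)]
        nlinarith [hB']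
    _ = 8 * B * harmonicSum K ^ 3 := by
        simp only [← mul_sum, ← sum_mul, harmonicSum]
        ring

/-- The pairs of distinct nonzero differences. -/
noncomputable def diffPairs (X : Finset ℝ) : Finset (ℝ × ℝ) :=
  {p ∈ (X - X).erase 0 ×ˢ (X - X).erase 0 | p.1 ≠ p.2}

/-- The weighted number of nondegenerate triangles of differences. -/
noncomputable def triangleEnergy (X : Finset ℝ) : ℝ :=
  ∑ p ∈ diffPairs X, ((diffRep X p.1 : ℝ) * diffRep X p.2 * diffRep X (p.1 - p.2)) ^ 2

/-- Dilating a triangle of popular differences of `X` by the elements of `S` gives rich lines. -/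
lemma card_pow_mul_triangleEnergy_cube_le {S X : Finset ℝ} (hS : (0 : ℝ) ∉ S) (hX : (0 : ℝ) ∉ X)
    {K : ℕ} (hXK : #X ≤ K) (hK : #(S * X) ^ 2 ≤ K) (hK1 : 1 ≤ K) (hS1 : S.Nonempty) :
    (#S : ℝ) ^ 7 * triangleEnergy X ^ 3 ≤
      512 * 6000 * 486 ^ 6 * ((#X : ℝ) ^ 8 * (#(S * X) : ℝ) ^ 12 * (#(S * (S * X)) : ℝ) ^ 4) *
        harmonicSum K ^ 10 := by
  have hN : (0 : ℝ) < #S := by exact_mod_cast hS1.card_pos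
  have hH := one_le_harmonicSum hK1
  have hH0 : 0 ≤ harmonicSum K := zero_le_one.trans hH
  have hSX : (0 : ℝ) ∉ S * X := by
    intro h
    obtain ⟨s, hs, x, hx, h⟩ := mem_mul.1 h
    rcases mul_eq_zero.1 h with rfl | rfl
    exacts [hS hs, hX hx]
  set Y : ℝ := 6000 * 486 ^ 6 *
    ((#X : ℝ) ^ 8 * (#(S * X) : ℝ) ^ 12 * (#(S * (S * X)) : ℝ) ^ 4) * harmonicSum K / (#S : ℝ) ^ 7
    with hY
  have hY0 : 0 ≤ Y := by positivity
  set B : ℝ := Y ^ ((1 : ℝ) / 3) with hB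
  have hB0 : 0 ≤ B := Real.rpow_nonneg hY0 _
  have hB3 : B ^ 3 = Y := by
    rw [hB, ← Real.rpow_natCast, ← Real.rpow_mul hY0]
    norm_num
  have key : triangleEnergy X ≤ 8 * B * harmonicSum K ^ 3 := by
    refine sum_sq_mul_sq_mul_sq_le (diffPairs X) (diffRep X) K B
      (fun d => (diffRep_le X d).trans hXK) fun k₁ h₁ k₂ h₂ k₃ h₃ => ?_
    replace h₁ := (mem_Icc.1 h₁).1
    replace h₂ := (mem_Icc.1 h₂).1
    replace h₃ := (mem_Icc.1 h₃).1
    have t1 : #{p ∈ diffPairs X |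
        k₁ ≤ diffRep X p.1 ∧ k₂ ≤ diffRep X p.2 ∧ k₃ ≤ diffRep X (p.1 - p.2)} ≤
        #{p ∈ (popularDiffs X k₁).erase 0 ×ˢ popularDiffs X k₂ | p.1 - p.2 ∈ popularDiffs X k₃} := by
      refine card_le_card fun p hp => ?_
      simp only [diffPairs, popularDiffs, mem_filter, mem_product, mem_erase] at hp ⊢
      exact ⟨⟨⟨hp.1.1.1.1, hp.1.1.1.2, hp.2.1⟩, hp.1.1.2.2, hp.2.2.1⟩,
        mem_sub_of_diffRep_pos (h₃.trans hp.2.2.2), hp.2.2.2⟩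
    have hRK : #(popularDiffs (S * X) k₁) ≤ K := by
      refine le_trans ((card_filter_le _ _).trans ?_) hK
      rw [sq]
      exact card_sub_le
    have t2 := card_mul_cube_triangles_le (R₂ := popularDiffs X k₂) (R₃ := popularDiffs X k₃) hS
      (notMem_erase 0 (popularDiffs X k₁))
      (fun s hs d hd => mul_mem_popularDiffs hS h₁ hs (mem_of_mem_erase hd)) hRK hK1
    have e1 : (#S * #(popularDiffs (S * X) k₁) * k₁ ^ 3 : ℝ) ≤
      486 * (#(S * X) ^ 2 * #(S * (S * X)) ^ 2) := by
        exact_mod_cast card_popularDiffs_mul_le hS hSX h₁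
    have e2 : (#S * #(popularDiffs X k₂) * k₂ ^ 3 : ℝ) ≤ 486 * (#X ^ 2 * #(S * X) ^ 2) := by
      exact_mod_cast card_popularDiffs_mul_le hS hX h₂
    have e3 : (#S * #(popularDiffs X k₃) * k₃ ^ 3 : ℝ) ≤ 486 * (#X ^ 2 * #(S * X) ^ 2) := by
      exact_mod_cast card_popularDiffs_mul_le hS hX h₃
    refine (mul_le_mul_of_nonneg_right (Nat.cast_le.2 t1) (sq_nonneg _)).trans ?_
    refine le_of_pow_le_pow_left₀ three_ne_zero hB0 ?_
    rw [hB3, hY, le_div_iff₀ (by positivity)]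
    set t : ℝ := (#{p ∈ (popularDiffs X k₁).erase 0 ×ˢ popularDiffs X k₂ |
      p.1 - p.2 ∈ popularDiffs X k₃} : ℝ)
    calc (t * ((k₁ : ℝ) * k₂ * k₃) ^ 2) ^ 3 * (#S : ℝ) ^ 7
        = (#S * t ^ 3) * ((#S : ℝ) ^ 6 * ((k₁ : ℝ) * k₂ * k₃) ^ 6) := by ring
      _ ≤ (6000 * ((#(popularDiffs (S * X) k₁) : ℝ) * #(popularDiffs X k₂) *
            #(popularDiffs X k₃)) ^ 2 * harmonicSum K) *
            ((#S : ℝ) ^ 6 * ((k₁ : ℝ) * k₂ * k₃) ^ 6) := by gcongr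
      _ = 6000 * harmonicSum K * ((#S * #(popularDiffs (S * X) k₁) * k₁ ^ 3 : ℝ) *
            (#S * #(popularDiffs X k₂) * k₂ ^ 3 : ℝ) *
            (#S * #(popularDiffs X k₃) * k₃ ^ 3 : ℝ)) ^ 2 := by ring
      _ ≤ 6000 * harmonicSum K * ((486 * (#(S * X) ^ 2 * #(S * (S * X)) ^ 2)) *
            (486 * (#X ^ 2 * #(S * X) ^ 2)) * (486 * (#X ^ 2 * #(S * X) ^ 2))) ^ 2 := by gcongr
      _ = _ := by ring
  have hF0 : 0 ≤ triangleEnergy X := sum_nonneg fun _ _ => sq_nonneg _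
  calc (#S : ℝ) ^ 7 * triangleEnergy X ^ 3 ≤ (#S : ℝ) ^ 7 * (8 * B * harmonicSum K ^ 3) ^ 3 := by
        gcongr
    _ = (#S : ℝ) ^ 7 * 512 * B ^ 3 * harmonicSum K ^ 9 := by ring
    _ = _ := by
        rw [hB3, hY]
        field_simp

/-! ### Traces of powers of a Gram matrix -/

/-- A lower bound for the trace of the cube of a Gram matrix in terms of the sum of its entries. -/
lemma sum_gram_cube_le {α β : Type*} (X : Finset α) (D : Finset β) (M : α → β → ℝ) (T : α → α → ℝ)
    (hT : ∀ x ∈ X, ∀ y ∈ X, T x y = ∑ t ∈ D, M x t * M y t) :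
    (∑ x ∈ X, ∑ y ∈ X, T x y) ^ 4 ≤
      (#X : ℝ) ^ 3 * (∑ x ∈ X, ∑ y ∈ X, ∑ z ∈ X, T x y * T x z * T y z) *
        (∑ x ∈ X, ∑ y ∈ X, T x y) := by
  set E := ∑ x ∈ X, ∑ y ∈ X, T x y with hE
  set tr := ∑ x ∈ X, ∑ y ∈ X, ∑ z ∈ X, T x y * T x z * T y z with htr
  let w : α → ℝ := fun x => ∑ y ∈ X, T x y
  let g : β → ℝ := fun t => ∑ x ∈ X, M x t
  let Q : α → β → ℝ := fun x t => ∑ y ∈ X, T x y * M y t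
  have hw : ∀ x ∈ X, w x = ∑ t ∈ D, M x t * g t := by
    intro x hx
    simp only [w, g, mul_sum]
    rw [sum_comm]
    exact sum_congr rfl fun y hy => hT x hx y hy
  have hg : ∑ t ∈ D, g t ^ 2 = E := by
    rw [hE]
    calc ∑ t ∈ D, g t ^ 2 = ∑ t ∈ D, ∑ x ∈ X, M x t * g t := by
          refine sum_congr rfl fun t _ => ?_
          rw [← sum_mul, sq]
      _ = ∑ x ∈ X, ∑ t ∈ D, M x t * g t := sum_comm
      _ = _ := sum_congr rfl fun x hx => (hw x hx).symm
  have hQ : ∑ x ∈ X, ∑ t ∈ D, Q x t ^ 2 = tr := by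
    refine sum_congr rfl fun x _ => ?_
    simp only [Q, sq, sum_mul_sum]
    rw [sum_comm]
    refine sum_congr rfl fun y hy => ?_
    rw [sum_comm]
    refine sum_congr rfl fun z hz => ?_
    rw [hT y hy z hz, mul_sum]
    exact sum_congr rfl fun t _ => by ring
  have h1 : E ^ 2 ≤ #X * ∑ x ∈ X, w x ^ 2 := sq_sum_le_card_mul_sum_sq
  have hTsymm : ∀ x ∈ X, ∀ y ∈ X, T x y = T y x := fun x hx y hy => by
    rw [hT x hx y hy, hT y hy x hx]
    exact sum_congr rfl fun t _ => mul_comm _ _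
  have h2 : ∑ x ∈ X, w x ^ 2 = ∑ p ∈ X ×ˢ D, Q p.1 p.2 * g p.2 := by
    rw [sum_product]
    calc ∑ y ∈ X, w y ^ 2 = ∑ y ∈ X, ∑ x ∈ X, T x y * w y := by
          refine sum_congr rfl fun y hy => ?_
          rw [← sum_mul, sq]
          congr 1
          exact sum_congr rfl fun x hx => hTsymm y hy x hx
      _ = ∑ x ∈ X, ∑ y ∈ X, T x y * w y := sum_comm
      _ = ∑ x ∈ X, ∑ t ∈ D, Q x t * g t := by
          refine sum_congr rfl fun x _ => ?_
          simp only [Q, sum_mul]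
          rw [sum_comm]
          refine sum_congr rfl fun y hy => ?_
          rw [hw y hy, mul_sum]
          exact sum_congr rfl fun t _ => by ring
  have h3 : (∑ x ∈ X, w x ^ 2) ^ 2 ≤ tr * (#X * E) := by
    rw [h2]
    refine (sum_mul_sq_le_sq_mul_sq _ _ _).trans (le_of_eq ?_)
    rw [sum_product, sum_product, hQ]
    simp only [hg, sum_const, nsmul_eq_mul]
  calc E ^ 4 = (E ^ 2) ^ 2 := by ring
    _ ≤ (#X * ∑ x ∈ X, w x ^ 2) ^ 2 := by gcongr
    _ = (#X : ℝ) ^ 2 * (∑ x ∈ X, w x ^ 2) ^ 2 := by ring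
    _ ≤ (#X : ℝ) ^ 2 * (tr * (#X * E)) := by gcongr
    _ = _ := by ring

/-- The additive energy. -/
noncomputable def energy (X : Finset ℝ) : ℝ := ∑ x ∈ X, ∑ y ∈ X, (diffRep X (x - y) : ℝ)

lemma diffRep_sub_eq_sum (X : Finset ℝ) {x y : ℝ} (hx : x ∈ X) :
    (diffRep X (x - y) : ℝ) =
      ∑ t ∈ X - X, (if x + t ∈ X then (1 : ℝ) else 0) * (if y + t ∈ X then 1 else 0) := by
  simp only [mul_ite, mul_one, mul_zero, ← ite_and]
  rw [sum_boole, diffRep]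
  norm_cast
  refine card_nbij' (fun a => a - x) (fun t => x + t) ?_ ?_ ?_ ?_
  · intro a ha
    simp only [mem_coe, mem_filter] at ha ⊢
    refine ⟨sub_mem_sub ha.1 hx, ?_, ?_⟩
    · rw [show y + (a - x) = a - (x - y) by ring]
      exact ha.2
    · simpa using ha.1
  · intro t ht
    simp only [mem_coe, mem_filter] at ht ⊢
    refine ⟨ht.2.2, ?_⟩
    rw [show x + t - (x - y) = y + t by ring]
    exact ht.2.1
  · intro a _
    simp
  · intro t _
    simp

lemma sum_sum_sub_eq (X : Finset ℝ) (h : ℝ → ℝ) :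
    ∑ x ∈ X, ∑ y ∈ X, h (x - y) = ∑ d ∈ X - X, diffRep X d * h d := by
  rw [← sum_product', ← sum_fiberwise_of_maps_to (t := X - X) (g := fun p : ℝ × ℝ => p.1 - p.2)
    (fun p hp => sub_mem_sub (mem_product.1 hp).1 (mem_product.1 hp).2)]
  refine sum_congr rfl fun d _ => ?_
  rw [sum_congr rfl (g := fun _ => h d) fun p hp => by rw [(mem_filter.1 hp).2], sum_const,
    nsmul_eq_mul, diffRep]
  congr 2
  refine card_nbij' Prod.fst (fun x => (x, x - d)) ?_ ?_ ?_ ?_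
  · rintro ⟨x, y⟩ hp
    simp only [mem_coe, mem_filter, mem_product] at hp ⊢
    obtain ⟨⟨hx, hy⟩, rfl⟩ := hp
    simpa using ⟨hx, hy⟩
  · intro x hx
    simp only [mem_coe, mem_filter, mem_product] at hx ⊢
    simpa using hx
  · rintro ⟨x, y⟩ hp
    simp only [mem_coe, mem_filter, mem_product] at hp
    rw [← hp.2]
    simp
  · intro x _
    rfl

lemma thirdEnergy_nonneg (X : Finset ℝ) : 0 ≤ thirdEnergy X := sum_nonneg fun _ _ => by positivity

lemma triangleEnergy_nonneg (X : Finset ℝ) : 0 ≤ triangleEnergy X :=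
  sum_nonneg fun _ _ => sq_nonneg _

/-- The triples of distinct elements. -/
noncomputable def distinctTriples (X : Finset ℝ) : Finset (ℝ × ℝ × ℝ) :=
  {q ∈ X ×ˢ X ×ˢ X | q.1 ≠ q.2.1 ∧ q.1 ≠ q.2.2 ∧ q.2.1 ≠ q.2.2}

lemma card_collisions_distinctTriples_le (X : Finset ℝ) :
    (#{p ∈ distinctTriples X ×ˢ distinctTriples X |
      (p.1.1 - p.1.2.1, p.1.1 - p.1.2.2) = (p.2.1 - p.2.2.1, p.2.1 - p.2.2.2)} : ℝ) ≤
        thirdEnergy X := by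
  have h : thirdEnergy X = (#((X - X).sigma fun d =>
      {x ∈ X | x - d ∈ X} ×ˢ {x ∈ X | x - d ∈ X} ×ˢ {x ∈ X | x - d ∈ X}) : ℕ) := by
    rw [card_sigma, thirdEnergy]
    push_cast
    refine sum_congr rfl fun d _ => ?_
    rw [card_product, card_product, diffRep]
    push_cast
    ring
  rw [h, Nat.cast_le]
  refine card_le_card_of_injOn (fun p => (⟨p.1.1 - p.2.1, p.1⟩ : Σ _ : ℝ, ℝ × ℝ × ℝ)) ?_ ?_
  · rintro ⟨⟨x, y, z⟩, x', y', z'⟩ hp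
    simp only [distinctTriples, mem_coe, mem_filter, mem_product, mem_sigma, Prod.mk.injEq] at hp ⊢
    obtain ⟨⟨⟨⟨hx, hy, hz⟩, -⟩, ⟨hx', hy', hz'⟩, -⟩, h1, h2⟩ := hp
    refine ⟨sub_mem_sub hx hx', ⟨hx, ?_⟩, ⟨hy, ?_⟩, hz, ?_⟩
    · simpa using hx'
    · rwa [show y - (x - x') = y' by linarith]
    · rwa [show z - (x - x') = z' by linarith]
  · rintro ⟨⟨x, y, z⟩, x', y', z'⟩ hp ⟨⟨a, b, c⟩, a', b', c'⟩ hq h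
    simp only [mem_coe, mem_filter, Prod.mk.injEq] at hp hq
    simp only [Sigma.mk.injEq, Prod.mk.injEq, heq_eq_eq] at h
    obtain ⟨h0, rfl, rfl, rfl⟩ := h
    have h1 := hp.2
    have h2 := hq.2
    simp only [Prod.mk.injEq, true_and]
    exact ⟨by linarith, by linarith, by linarith⟩

lemma sum_distinctTriples_le (X : Finset ℝ) :
    ∑ q ∈ distinctTriples X, (diffRep X (q.1 - q.2.1) : ℝ) * diffRep X (q.1 - q.2.2) *
      diffRep X (q.2.1 - q.2.2) ≤ √(thirdEnergy X * triangleEnergy X) := by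
  refine Real.le_sqrt_of_sq_le ?_
  have hmaps : ∀ q ∈ distinctTriples X, (q.1 - q.2.1, q.1 - q.2.2) ∈ diffPairs X := by
    rintro ⟨x, y, z⟩ hq
    simp only [distinctTriples, mem_filter, mem_product] at hq
    obtain ⟨⟨hx, hy, hz⟩, h1, h2, h3⟩ := hq
    simp only [diffPairs, mem_filter, mem_product, mem_erase]
    exact ⟨⟨⟨sub_ne_zero.2 h1, sub_mem_sub hx hy⟩, sub_ne_zero.2 h2, sub_mem_sub hx hz⟩,
      by simpa using h3⟩
  have h1 : ∑ q ∈ distinctTriples X, (diffRep X (q.1 - q.2.1) : ℝ) * diffRep X (q.1 - q.2.2) *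
      diffRep X (q.2.1 - q.2.2) = ∑ p ∈ diffPairs X,
        (#{q ∈ distinctTriples X | (q.1 - q.2.1, q.1 - q.2.2) = p} : ℝ) *
          ((diffRep X p.1 : ℝ) * diffRep X p.2 * diffRep X (p.1 - p.2)) := by
    rw [← sum_fiberwise_of_maps_to hmaps]
    refine sum_congr rfl fun p _ => ?_
    rw [← nsmul_eq_mul, ← sum_const]
    refine sum_congr rfl fun q hq => ?_
    rw [← (mem_filter.1 hq).2]
    dsimp only
    rw [show q.1 - q.2.1 - (q.1 - q.2.2) = -(q.2.1 - q.2.2) by ring, diffRep_neg]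
  rw [h1]
  refine (sum_mul_sq_le_sq_mul_sq _ _ _).trans
    (mul_le_mul_of_nonneg_right ?_ (triangleEnergy_nonneg X))
  refine le_trans (le_of_eq ?_) (card_collisions_distinctTriples_le X)
  exact_mod_cast sum_sq_card_fiber_eq_card_collisions (distinctTriples X) (diffPairs X)
    (fun q => (q.1 - q.2.1, q.1 - q.2.2)) hmaps

lemma sum_sum_sum_diffRep_le (X : Finset ℝ) :
    ∑ x ∈ X, ∑ y ∈ X, ∑ z ∈ X,
        (diffRep X (x - y) : ℝ) * diffRep X (x - z) * diffRep X (y - z) ≤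
      3 * (#X * thirdEnergy X) + √(thirdEnergy X * triangleEnergy X) := by
  let f : ℝ → ℝ → ℝ → ℝ := fun x y z =>
    (diffRep X (x - y) : ℝ) * diffRep X (x - z) * diffRep X (y - z)
  have hf : ∀ x y z, 0 ≤ f x y z := fun x y z => by positivity
  have hsq : ∑ x ∈ X, ∑ y ∈ X, (diffRep X (x - y) : ℝ) ^ 2 = thirdEnergy X := by
    rw [sum_sum_sub_eq X fun d => (diffRep X d : ℝ) ^ 2]
    exact sum_congr rfl fun d _ => by ring
  have hle : ∀ x ∈ X, ∀ y ∈ X, ∀ z ∈ X, f x y z ≤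
      (if x = y then f x y z else 0) + (if x = z then f x y z else 0) +
      (if y = z then f x y z else 0) +
      (if x ≠ y ∧ x ≠ z ∧ y ≠ z then f x y z else 0) := by
    intro x _ y _ z _
    have := hf x y z
    split_ifs <;> first | linarith | tauto
  have e1 : ∑ x ∈ X, ∑ y ∈ X, ∑ z ∈ X, (if x = y then f x y z else 0) = #X * thirdEnergy X := by
    rw [← hsq, mul_sum]
    refine sum_congr rfl fun x hx => ?_
    rw [sum_comm, mul_sum]
    refine sum_congr rfl fun z _ => ?_
    rw [sum_ite_eq, if_pos hx]
    simp only [f, sub_self, diffRep_zero]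
    ring
  have e2 : ∑ x ∈ X, ∑ y ∈ X, ∑ z ∈ X, (if x = z then f x y z else 0) = #X * thirdEnergy X := by
    rw [← hsq, mul_sum]
    refine sum_congr rfl fun x hx => ?_
    rw [mul_sum]
    refine sum_congr rfl fun y _ => ?_
    rw [sum_ite_eq, if_pos hx]
    simp only [f, sub_self, diffRep_zero]
    rw [show y - x = -(x - y) by ring, diffRep_neg]
    ring
  have e3 : ∑ x ∈ X, ∑ y ∈ X, ∑ z ∈ X, (if y = z then f x y z else 0) = #X * thirdEnergy X := by
    rw [← hsq, mul_sum]
    refine sum_congr rfl fun x hx => ?_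
    rw [mul_sum]
    refine sum_congr rfl fun y hy => ?_
    rw [sum_ite_eq, if_pos hy]
    simp only [f, sub_self, diffRep_zero]
    ring
  have e4 : ∑ x ∈ X, ∑ y ∈ X, ∑ z ∈ X, (if x ≠ y ∧ x ≠ z ∧ y ≠ z then f x y z else 0) ≤
      √(thirdEnergy X * triangleEnergy X) := by
    refine le_trans (le_of_eq ?_) (sum_distinctTriples_le X)
    rw [distinctTriples, sum_filter, sum_product]
    exact sum_congr rfl fun x _ => by rw [sum_product]
  have := sum_le_sum fun x hx => sum_le_sum fun y hy => sum_le_sum fun z hz => hle x hx y hy z hz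
  simp only [sum_add_distrib] at this
  rw [e1, e2, e3] at this
  linarith

/-- The additive energy is controlled by the third energy and the triangle energy. -/
lemma energy_cube_le (X : Finset ℝ) :
    energy X ^ 3 ≤ (#X : ℝ) ^ 3 *
      (3 * (#X * thirdEnergy X) + √(thirdEnergy X * triangleEnergy X)) := by
  have h := sum_gram_cube_le X (X - X) (fun x t => if x + t ∈ X then (1 : ℝ) else 0)
    (fun x y => (diffRep X (x - y) : ℝ)) (fun x hx y _ => diffRep_sub_eq_sum X hx)
  have hE : 0 ≤ energy X := sum_nonneg fun _ _ => sum_nonneg fun _ _ => Nat.cast_nonneg _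
  have h3 := thirdEnergy_nonneg X
  rcases hE.eq_or_lt with hE | hE
  · rw [← hE, zero_pow three_ne_zero]
    positivity
  refine le_of_mul_le_mul_right ?_ hE
  calc energy X ^ 3 * energy X = energy X ^ 4 := by ring
    _ ≤ _ := h
    _ ≤ _ := by
      gcongr
      · exact sum_sum_sum_diffRep_le X
      · exact le_rfl

/-! ### Ratios of sums -/

/-- The ratios `(a + b) / (a + c)` with `a`, `b`, `c` in `A`. -/
noncomputable def sumRatios (A : Finset ℝ) : Finset ℝ :=
  (A ×ˢ A ×ˢ A).image fun q => (q.1 + q.2.1) / (q.1 + q.2.2)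

lemma add_ne_zero_of_mem {A : Finset ℝ} (hS : (0 : ℝ) ∉ A + A) {a b : ℝ} (ha : a ∈ A)
    (hb : b ∈ A) : a + b ≠ 0 := fun h => hS (h ▸ add_mem_add ha hb)

lemma card_collisions_ratio_le {A : Finset ℝ} (hS : (0 : ℝ) ∉ A + A) {K : ℕ} (hK : 2 * #A ≤ K) :
    (#{p ∈ (A ×ˢ A ×ˢ A) ×ˢ (A ×ˢ A ×ˢ A) | (p.1.1 + p.1.2.1) / (p.1.1 + p.1.2.2) =
      (p.2.1 + p.2.2.1) / (p.2.1 + p.2.2.2)} : ℝ) ≤ 23328 * (#A : ℝ) ^ 4 * harmonicSum K := by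
  set C := {p ∈ (A ×ˢ A ×ˢ A) ×ˢ (A ×ˢ A ×ˢ A) | (p.1.1 + p.1.2.1) / (p.1.1 + p.1.2.2) =
      (p.2.1 + p.2.2.1) / (p.2.1 + p.2.2.2)} with hC
  set X := A ∪ -A with hX
  let line : (ℝ × ℝ × ℝ) × (ℝ × ℝ × ℝ) → ℝ × ℝ := fun p =>
    ((p.2.1 + p.2.2.1) / (p.1.1 + p.1.2.1),
      p.2.2.1 - (p.2.1 + p.2.2.1) / (p.1.1 + p.1.2.1) * p.1.2.1)
  let L := C.image line
  let F : ℝ × ℝ → Finset ℝ := fun l => {x ∈ X | l.1 * x + l.2 ∈ X}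
  have hXc : #X ≤ 2 * #A := by
    refine (card_union_le _ _).trans ?_
    rw [card_neg]
    omega
  have hline : ∀ p ∈ C, (line p).1 ≠ 0 ∧ (line p).1 * -p.1.1 + (line p).2 = -p.2.1 ∧
      (line p).1 * p.1.2.1 + (line p).2 = p.2.2.1 ∧
      (line p).1 * p.1.2.2 + (line p).2 = p.2.2.2 := by
    rintro ⟨⟨a, b, c⟩, a', b', c'⟩ hp
    simp only [hC, mem_filter, mem_product] at hp
    obtain ⟨⟨⟨ha, hb, hc⟩, ha', hb', hc'⟩, h⟩ := hp
    have h1 := add_ne_zero_of_mem hS ha hb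
    have h2 := add_ne_zero_of_mem hS ha hc
    have h3 := add_ne_zero_of_mem hS ha' hb'
    have h4 := add_ne_zero_of_mem hS ha' hc'
    rw [div_eq_div_iff h2 h4] at h
    dsimp only [line]
    refine ⟨div_ne_zero h3 h1, ?_, ?_, ?_⟩
    · field_simp
      ring
    · ring
    · field_simp
      linarith
  have hneg : ∀ {a}, a ∈ A → -a ∈ X := fun ha => mem_union_right _ (by simpa using ha)
  have hmemF : ∀ p ∈ C, -p.1.1 ∈ F (line p) ∧ p.1.2.1 ∈ F (line p) ∧ p.1.2.2 ∈ F (line p) := by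
    intro p hp
    obtain ⟨-, h1, h2, h3⟩ := hline p hp
    simp only [hC, mem_filter, mem_product] at hp
    obtain ⟨⟨⟨ha, hb, hc⟩, ha', hb', hc'⟩, -⟩ := hp
    simp only [F, mem_filter, h1, h2, h3]
    exact ⟨⟨hneg ha, hneg ha'⟩, ⟨mem_union_left _ hb, mem_union_left _ hb'⟩,
      mem_union_left _ hc, mem_union_left _ hc'⟩
  have hcard : #C ≤ #(L.sigma fun l => F l ×ˢ F l ×ˢ F l) := by
    refine card_le_card_of_injOn
      (fun p => (⟨line p, -p.1.1, p.1.2.1, p.1.2.2⟩ : Σ _ : ℝ × ℝ, ℝ × ℝ × ℝ)) ?_ ?_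
    · intro p hp
      simp only [mem_coe, mem_sigma, mem_product]
      exact ⟨mem_image_of_mem _ hp, hmemF p hp⟩
    · intro p hp q hq h
      simp only [Sigma.mk.injEq, heq_eq_eq, Prod.mk.injEq, neg_inj] at h
      obtain ⟨h0, h1, h2, h3⟩ := h
      obtain ⟨-, i1, i2, i3⟩ := hline p hp
      obtain ⟨-, j1, j2, j3⟩ := hline q hq
      rw [h0, h1, j1, neg_inj] at i1
      rw [h0, h2, j2] at i2
      rw [h0, h3, j3] at i3
      exact Prod.ext (Prod.ext h1 (Prod.ext h2 h3))
        (Prod.ext i1.symm (Prod.ext i2.symm i3.symm))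
  have hsum : (#C : ℝ) ≤ ∑ l ∈ L, (lineCount X X l : ℝ) ^ 3 := by
    refine (Nat.cast_le.2 hcard).trans (le_of_eq ?_)
    rw [card_sigma]
    push_cast
    refine sum_congr rfl fun l _ => ?_
    simp only [card_product, F, lineCount]
    push_cast
    ring
  have hH : 0 ≤ harmonicSum K := sum_nonneg fun _ _ => by positivity
  refine hsum.trans ((sum_lineCount_cube_le X X L K (hXc.trans hK) ?_ ?_).trans ?_)
  · intro l hl
    obtain ⟨p, hp, rfl⟩ := mem_image.1 hl
    exact (hline p hp).1
  · intro l hl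
    obtain ⟨p, hp, rfl⟩ := mem_image.1 hl
    refine one_lt_card.2 ⟨_, (hmemF p hp).1, _, (hmemF p hp).2.1, ?_⟩
    simp only [hC, mem_filter, mem_product] at hp
    exact fun h => add_ne_zero_of_mem hS hp.1.1.1 hp.1.1.2.1 (by linarith)
  · have : (#X : ℝ) ≤ 2 * #A := by exact_mod_cast hXc
    calc 1458 * ((#X : ℝ) ^ 2 * (#X : ℝ) ^ 2) * harmonicSum K
        ≤ 1458 * ((2 * #A : ℝ) ^ 2 * (2 * #A : ℝ) ^ 2) * harmonicSum K := by gcongr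
      _ = _ := by ring

lemma card_sq_le_card_sumRatios {A : Finset ℝ} (hA : A.Nonempty) (hS : (0 : ℝ) ∉ A + A) {K : ℕ}
    (hK : 2 * #A ≤ K) : (#A : ℝ) ^ 2 ≤ 23328 * #(sumRatios A) * harmonicSum K := by
  have hn : (0 : ℝ) < #A := by exact_mod_cast hA.card_pos
  have h := card_sq_le_card_mul_card_collisions (A ×ˢ A ×ˢ A) (sumRatios A)
    (fun q => (q.1 + q.2.1) / (q.1 + q.2.2)) (fun q hq => mem_image_of_mem _ hq)
  have h' := (Nat.cast_le (α := ℝ)).2 h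
  rw [card_product, card_product] at h'
  push_cast at h'
  refine le_of_mul_le_mul_right ?_ (pow_pos hn 4)
  calc (#A : ℝ) ^ 2 * (#A : ℝ) ^ 4 = ((#A : ℝ) * (#A * #A)) ^ 2 := by ring
    _ ≤ _ := h'
    _ ≤ #(sumRatios A) * (23328 * (#A : ℝ) ^ 4 * harmonicSum K) := by
      gcongr
      exact card_collisions_ratio_le hS hK
    _ = _ := by ring

lemma card_mul_card_sumRatios_mul_card_le_energy {A : Finset ℝ} (hS : (0 : ℝ) ∉ A + A) :
    (#(A + A) * #(sumRatios A) * #A : ℝ) ≤ energy ((A + A) * (A + A)) := by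
  set S := A + A with hSdef
  have hrep : ∀ τ ∈ sumRatios A, ∃ q ∈ A ×ˢ A ×ˢ A, (q.1 + q.2.1) / (q.1 + q.2.2) = τ :=
    fun τ hτ => mem_image.1 hτ
  choose! q hq hqτ using hrep
  let φ : ℝ × ℝ → ℝ × ℝ := fun p =>
    (p.1 * ((q p.2).1 + (q p.2).2.1), p.1 * ((q p.2).1 + (q p.2).2.2))
  have hinj : Set.InjOn φ ↑(S ×ˢ sumRatios A) := by
    rintro ⟨s, τ⟩ hp ⟨s', τ'⟩ hp' h
    simp only [mem_coe, mem_product] at hp hp'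
    simp only [φ, Prod.mk.injEq] at h
    have hs0 : s ≠ 0 := fun h => hS (h ▸ hp.1)
    have hs0' : s' ≠ 0 := fun h => hS (h ▸ hp'.1)
    have hτ : τ = τ' := by
      rw [← hqτ τ hp.2, ← hqτ τ' hp'.2, ← mul_div_mul_left _ _ hs0, h.1, h.2,
        mul_div_mul_left _ _ hs0']
    subst hτ
    have hqm := hq τ hp.2
    simp only [mem_product] at hqm
    rw [mul_right_cancel₀ (add_ne_zero_of_mem hS hqm.1 hqm.2.1) h.1]
  have hmem : (S ×ˢ sumRatios A).image φ ⊆ (S * S) ×ˢ (S * S) := by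
    intro p hp
    obtain ⟨⟨s, τ⟩, hsτ, rfl⟩ := mem_image.1 hp
    obtain ⟨hs, hτ⟩ := mem_product.1 hsτ
    have hqm := hq τ hτ
    simp only [mem_product] at hqm
    exact mem_product.2 ⟨mul_mem_mul hs (add_mem_add hqm.1 hqm.2.1),
      mul_mem_mul hs (add_mem_add hqm.1 hqm.2.2)⟩
  have hlow : ∀ p ∈ (S ×ˢ sumRatios A).image φ, (#A : ℝ) ≤ diffRep (S * S) (p.1 - p.2) := by
    intro p hp
    obtain ⟨⟨s, τ⟩, hsτ, rfl⟩ := mem_image.1 hp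
    obtain ⟨hs, hτ⟩ := mem_product.1 hsτ
    have hqm := hq τ hτ
    simp only [mem_product] at hqm
    have hs0 : s ≠ 0 := fun h => hS (h ▸ hs)
    rw [Nat.cast_le]
    refine card_le_card_of_injOn (fun e => s * (e + (q τ).2.1)) (fun e he => ?_)
      (fun e _ e' _ h => by simpa [hs0] using h)
    simp only [mem_coe, mem_filter, φ] at he ⊢
    refine ⟨mul_mem_mul hs (add_mem_add he hqm.2.1), ?_⟩
    rw [show s * (e + (q τ).2.1) - (s * ((q τ).1 + (q τ).2.1) - s * ((q τ).1 + (q τ).2.2)) =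
      s * (e + (q τ).2.2) by ring]
    exact mul_mem_mul hs (add_mem_add he hqm.2.2)
  calc (#S * #(sumRatios A) * #A : ℝ) = ∑ p ∈ (S ×ˢ sumRatios A).image φ, (#A : ℝ) := by
        rw [sum_const, card_image_of_injOn hinj, card_product, nsmul_eq_mul]
        push_cast
        ring
    _ ≤ ∑ p ∈ (S ×ˢ sumRatios A).image φ, (diffRep (S * S) (p.1 - p.2) : ℝ) := sum_le_sum hlow
    _ ≤ ∑ p ∈ (S * S) ×ˢ (S * S), (diffRep (S * S) (p.1 - p.2) : ℝ) :=
        sum_le_sum_of_subset_of_nonneg hmem fun _ _ _ => Nat.cast_nonneg _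
    _ = _ := sum_product _ _ _

/-- The product set of a sumset has large additive energy. -/
lemma card_pow_five_le_energy {A : Finset ℝ} (hA : A.Nonempty) (hS : (0 : ℝ) ∉ A + A) {K : ℕ}
    (hK : 2 * #A ≤ K) :
    (#(A + A) : ℝ) ^ 5 ≤ (23328 * harmonicSum K * energy ((A + A) * (A + A))) ^ 2 := by
  have h1 := card_sq_le_card_sumRatios hA hS hK
  have h2 := card_mul_card_sumRatios_mul_card_le_energy hS
  have hH : 0 ≤ harmonicSum K := sum_nonneg fun _ _ => by positivity
  have h3 : (#(A + A) : ℝ) ≤ (#A : ℝ) ^ 2 := by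
    rw [sq]
    exact_mod_cast card_add_le
  have h4 : (#(A + A) : ℝ) * (#A : ℝ) ^ 3 ≤
      23328 * harmonicSum K * energy ((A + A) * (A + A)) := by
    calc (#(A + A) : ℝ) * (#A : ℝ) ^ 3 = #(A + A) * (#A : ℝ) ^ 2 * #A := by ring
      _ ≤ #(A + A) * (23328 * #(sumRatios A) * harmonicSum K) * #A := by gcongr
      _ = 23328 * harmonicSum K * (#(A + A) * #(sumRatios A) * #A) := by ring
      _ ≤ _ := by gcongr
  calc (#(A + A) : ℝ) ^ 5 = (#(A + A) : ℝ) ^ 2 * (#(A + A) : ℝ) ^ 3 := by ring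
    _ ≤ (#(A + A) : ℝ) ^ 2 * ((#A : ℝ) ^ 2) ^ 3 := by gcongr
    _ = (#(A + A) * (#A : ℝ) ^ 3) ^ 2 := by ring
    _ ≤ _ := by gcongr

/-! ### Product sets of nonzero reals -/

/-- Plünnecke's inequality for triple and quadruple product sets. -/
lemma card_triple_quadruple_mul_le {S : Finset ℝ} (hS : (0 : ℝ) ∉ S) (hne : S.Nonempty) :
    (#S : ℝ) ^ 2 * #(S * (S * S)) ≤ (#(S * S) : ℝ) ^ 3 ∧
      (#S : ℝ) ^ 3 * #(S * (S * (S * S))) ≤ (#(S * S) : ℝ) ^ 4 := by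
  have hN : (0 : ℝ) < #S := by exact_mod_cast hne.card_pos
  let ι : ℝˣ →* ℝ := Units.coeHom ℝ
  have hι : Function.Injective ι := Units.val_injective
  obtain ⟨U, rfl⟩ : ∃ U : Finset ℝˣ, U.image ι = S := by
    classical
    refine ⟨S.preimage ι hι.injOn, ?_⟩
    rw [image_preimage]
    exact filter_true_of_mem fun s hs => ⟨Units.mk0 s fun h => hS (h ▸ hs), rfl⟩
  rw [image_nonempty] at hne
  rw [card_image_of_injective _ hι] at hN
  simp only [← image_mul, card_image_of_injective _ hι]
  have key : ∀ k : ℕ, (#(U ^ k) : ℝ) ≤ ((#(U * U) : ℝ) / #U) ^ k * #U := fun k => by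
    have h := (NNRat.cast_le (K := ℝ)).2 (pluennecke_ruzsa_inequality_pow_mul hne U k)
    push_cast at h
    exact h
  have h3 := key 3
  have h4 := key 4
  rw [div_pow, div_mul_eq_mul_div, le_div_iff₀ (by positivity)] at h3 h4
  rw [show U * (U * U) = U ^ 3 by rw [pow_succ, sq, mul_assoc], ← pow_succ']
  constructor
  · refine le_of_mul_le_mul_right ?_ hN
    linarith
  · refine le_of_mul_le_mul_right ?_ hN
    linarith

/-! ### The growth estimate -/

/-- Elimination of the energies from the estimates relating them to the sizes of product sets. -/
lemma exists_pow_le_of_energy_estimates : ∃ C : ℝ, 1 ≤ C ∧ ∀ N v w u E E₃ F H : ℝ,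
    1 ≤ N → N ≤ v → 0 ≤ w → 0 ≤ u → 0 ≤ E → 0 ≤ E₃ → 0 ≤ F → 1 ≤ H →
    N ^ 7 * F ^ 3 ≤ 512 * 6000 * 486 ^ 6 * (v ^ 8 * w ^ 12 * u ^ 4) * H ^ 10 →
    E ^ 3 ≤ v ^ 3 * (3 * (v * E₃) + √(E₃ * F)) →
    N * E₃ ≤ 1458 * (v ^ 2 * w ^ 2) * H →
    N ^ 5 ≤ (23328 * H * E) ^ 2 →
    N ^ 2 * w ≤ v ^ 3 → N ^ 3 * u ≤ v ^ 4 →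
    N ^ 103 ≤ C * v ^ 102 * H ^ 31 := by
  obtain ⟨c₁, hc₁⟩ : ∃ c : ℝ, c = 512 * 6000 * 486 ^ 6 := ⟨_, rfl⟩
  obtain ⟨c₂, hc₂⟩ : ∃ c : ℝ, c = 1458 := ⟨_, rfl⟩
  obtain ⟨c₃, hc₃⟩ : ∃ c : ℝ, c = 23328 := ⟨_, rfl⟩
  have hc₁' : 1 ≤ c₁ := by rw [hc₁]; norm_num
  have hc₂' : 1 ≤ c₂ := by rw [hc₂]; norm_num
  have hc₃' : 1 ≤ c₃ := by rw [hc₃]; norm_num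
  rw [← hc₁, ← hc₂, ← hc₃]
  have hc : 1 ≤ 36 * c₃ ^ 6 * c₂ ^ 2 := by
    have := one_le_mul_of_one_le_of_one_le (one_le_pow₀ hc₃' (n := 6)) (one_le_pow₀ hc₂' (n := 2))
    linarith
  have hd : 0 ≤ 64 * c₃ ^ 18 * c₂ ^ 3 * c₁ := by positivity
  refine ⟨36 * c₃ ^ 6 * c₂ ^ 2 + 64 * c₃ ^ 18 * c₂ ^ 3 * c₁, by linarith, ?_⟩
  intro N v w u E E₃ F H hN hNv hw hu hE hE₃ hF hH hF3 hE3 hT hN5 hw3 hu4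
  have hv : 0 < v := by linarith
  have hv0 := hv.le
  have hN0 : 0 < N := by linarith
  have hH0 : 0 < H := by linarith
  rcases le_total √(E₃ * F) (3 * (v * E₃)) with h | h
  · have h1 : E ^ 3 ≤ 6 * v ^ 4 * E₃ := by
      refine hE3.trans ?_
      calc v ^ 3 * (3 * (v * E₃) + √(E₃ * F)) ≤ v ^ 3 * (3 * (v * E₃) + 3 * (v * E₃)) := by gcongr
        _ = _ := by ring
    have h2 : N ^ 25 ≤ 36 * c₃ ^ 6 * c₂ ^ 2 * v ^ 24 * H ^ 8 := by
      calc N ^ 25 = (N ^ 5) ^ 3 * N ^ 10 := by ring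
        _ ≤ ((c₃ * H * E) ^ 2) ^ 3 * N ^ 10 := by gcongr
        _ = c₃ ^ 6 * H ^ 6 * (E ^ 3) ^ 2 * N ^ 10 := by ring
        _ ≤ c₃ ^ 6 * H ^ 6 * (6 * v ^ 4 * E₃) ^ 2 * N ^ 10 := by gcongr
        _ = 36 * c₃ ^ 6 * H ^ 6 * v ^ 8 * (N * E₃) ^ 2 * N ^ 8 := by ring
        _ ≤ 36 * c₃ ^ 6 * H ^ 6 * v ^ 8 * (c₂ * (v ^ 2 * w ^ 2) * H) ^ 2 * N ^ 8 := by gcongr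
        _ = 36 * c₃ ^ 6 * c₂ ^ 2 * H ^ 8 * v ^ 12 * (N ^ 2 * w) ^ 4 := by ring
        _ ≤ 36 * c₃ ^ 6 * c₂ ^ 2 * H ^ 8 * v ^ 12 * (v ^ 3) ^ 4 := by gcongr
        _ = _ := by ring
    calc N ^ 103 = N ^ 25 * N ^ 78 := by ring
      _ ≤ (36 * c₃ ^ 6 * c₂ ^ 2 * v ^ 24 * H ^ 8) * v ^ 78 := by gcongr
      _ = 36 * c₃ ^ 6 * c₂ ^ 2 * v ^ 102 * H ^ 8 := by ring
      _ ≤ (36 * c₃ ^ 6 * c₂ ^ 2 + 64 * c₃ ^ 18 * c₂ ^ 3 * c₁) * v ^ 102 * H ^ 31 := by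
        gcongr
        · linarith
        · norm_num
  · have h1 : E ^ 3 ≤ 2 * v ^ 3 * √(E₃ * F) := by
      refine hE3.trans ?_
      calc v ^ 3 * (3 * (v * E₃) + √(E₃ * F)) ≤ v ^ 3 * (√(E₃ * F) + √(E₃ * F)) := by gcongr
        _ = _ := by ring
    have h2 : √(E₃ * F) ^ 2 = E₃ * F := Real.sq_sqrt (mul_nonneg hE₃ hF)
    have h3 : E ^ 18 ≤ 64 * v ^ 18 * (E₃ * F) ^ 3 := by
      calc E ^ 18 = (E ^ 3) ^ 6 := by ring
        _ ≤ (2 * v ^ 3 * √(E₃ * F)) ^ 6 := by gcongr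
        _ = 64 * v ^ 18 * (√(E₃ * F) ^ 2) ^ 3 := by ring
        _ = _ := by rw [h2]
    calc N ^ 103 = (N ^ 5) ^ 9 * N ^ 58 := by ring
      _ ≤ ((c₃ * H * E) ^ 2) ^ 9 * N ^ 58 := by gcongr
      _ = c₃ ^ 18 * H ^ 18 * E ^ 18 * N ^ 58 := by ring
      _ ≤ c₃ ^ 18 * H ^ 18 * (64 * v ^ 18 * (E₃ * F) ^ 3) * N ^ 58 := by gcongr
      _ = 64 * c₃ ^ 18 * H ^ 18 * v ^ 18 * (N * E₃) ^ 3 * (N ^ 7 * F ^ 3) * N ^ 48 := by ring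
      _ ≤ 64 * c₃ ^ 18 * H ^ 18 * v ^ 18 * (c₂ * (v ^ 2 * w ^ 2) * H) ^ 3 *
          (c₁ * (v ^ 8 * w ^ 12 * u ^ 4) * H ^ 10) * N ^ 48 := by gcongr
      _ = 64 * c₃ ^ 18 * c₂ ^ 3 * c₁ * H ^ 31 * v ^ 32 * (N ^ 2 * w) ^ 18 * (N ^ 3 * u) ^ 4 := by
        ring
      _ ≤ 64 * c₃ ^ 18 * c₂ ^ 3 * c₁ * H ^ 31 * v ^ 32 * (v ^ 3) ^ 18 * (v ^ 4) ^ 4 := by gcongr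
      _ = 64 * c₃ ^ 18 * c₂ ^ 3 * c₁ * v ^ 102 * H ^ 31 := by ring
      _ ≤ (36 * c₃ ^ 6 * c₂ ^ 2 + 64 * c₃ ^ 18 * c₂ ^ 3 * c₁) * v ^ 102 * H ^ 31 := by
        gcongr
        linarith

/-- The growth estimate for product sets of sumsets, before bounding the harmonic sum. -/
lemma exists_card_pow_le : ∃ C : ℝ, 1 ≤ C ∧ ∀ A : Finset ℝ, 2 ≤ #A → (0 : ℝ) ∉ A + A →
    (#(A + A) : ℝ) ^ 103 ≤
      C * (#((A + A) * (A + A)) : ℝ) ^ 102 * harmonicSum (#A ^ 12) ^ 31 := by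
  obtain ⟨C, hC, h⟩ := exists_pow_le_of_energy_estimates
  refine ⟨C, hC, fun A hA hS => ?_⟩
  have hAne : A.Nonempty := card_pos.1 (by omega)
  have hSne : (A + A).Nonempty := hAne.add hAne
  have hS0 : ∀ s ∈ A + A, s ≠ 0 := fun s hs h => hS (h ▸ hs)
  have hV : (0 : ℝ) ∉ (A + A) * (A + A) := by
    intro h
    obtain ⟨s, hs, t, ht, h⟩ := mem_mul.1 h
    exact mul_ne_zero (hS0 s hs) (hS0 t ht) h
  obtain ⟨s, hs⟩ := hSne
  have hN : #(A + A) ≤ #A ^ 2 := by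
    rw [sq]
    exact card_add_le
  have hv : #((A + A) * (A + A)) ≤ #A ^ 4 := by
    calc _ ≤ #(A + A) * #(A + A) := card_mul_le
      _ ≤ #A ^ 2 * #A ^ 2 := by gcongr
      _ = _ := by ring
  have hw : #((A + A) * ((A + A) * (A + A))) ^ 2 ≤ #A ^ 12 := by
    calc _ ≤ (#(A + A) * #((A + A) * (A + A))) ^ 2 := by
          gcongr
          exact card_mul_le
      _ ≤ (#A ^ 2 * #A ^ 4) ^ 2 := by gcongr
      _ = _ := by ring
  have hvK : #((A + A) * (A + A)) ≤ #A ^ 12 :=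
    hv.trans (Nat.pow_le_pow_right (by omega) (by omega))
  have hK1 : 1 ≤ #A ^ 12 := Nat.one_le_pow _ _ (by omega)
  have hK2 : 2 * #A ≤ #A ^ 12 := by
    calc 2 * #A ≤ #A * #A := by gcongr
      _ = #A ^ 2 := (sq _).symm
      _ ≤ _ := Nat.pow_le_pow_right (by omega) (by omega)
  have hP := card_triple_quadruple_mul_le hS ⟨s, hs⟩
  refine h _ _ _ _ (energy ((A + A) * (A + A))) (thirdEnergy ((A + A) * (A + A)))
    (triangleEnergy ((A + A) * (A + A))) _ ?_ ?_ (Nat.cast_nonneg _) (Nat.cast_nonneg _) ?_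
    (thirdEnergy_nonneg _) (triangleEnergy_nonneg _) (one_le_harmonicSum hK1)
    (card_pow_mul_triangleEnergy_cube_le hS hV hvK hw hK1 ⟨s, hs⟩) (energy_cube_le _)
    (card_mul_thirdEnergy_le hS hV hvK) (card_pow_five_le_energy hAne hS hK2) hP.1 hP.2
  · exact_mod_cast card_pos.2 ⟨s, hs⟩
  · exact_mod_cast card_le_card_mul_of_mem_ne_zero hs (hS0 s hs)
  · exact sum_nonneg fun _ _ => sum_nonneg fun _ _ => Nat.cast_nonneg _

lemma harmonicSum_pow_twelve_le {n : ℕ} (hn : 2 ≤ n) :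
    harmonicSum (n ^ 12) ≤ 13 * Real.logb 2 n := by
  have hn' : (2 : ℝ) ≤ n := by exact_mod_cast hn
  have h0 : 0 < Real.log 2 := Real.log_pos one_lt_two
  have h1 : Real.log 2 ≤ 1 := by linarith [Real.log_two_lt_d9]
  have h2 : Real.log 2 ≤ Real.log n := Real.log_le_log (by norm_num) hn'
  have hL : Real.log n = Real.logb 2 n * Real.log 2 := by
    rw [Real.logb, div_mul_cancel₀ _ h0.ne']
  have hL1 : 1 ≤ Real.logb 2 n := by rwa [Real.logb, one_le_div h0]
  refine (harmonicSum_le _).trans ?_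
  push_cast
  rw [Real.log_pow, hL]
  push_cast
  nlinarith

theorem stmt_14 :
    ∃ c C : ℝ, 0 < c ∧ 0 < C ∧ ∀ A : Finset ℝ,
      2 ≤ A.card → (0 : ℝ) ∉ A + A →
      c * ((A + A).card : ℝ) ^ ((1 : ℝ) + 1 / 398) /
          (Real.logb 2 (A.card : ℝ)) ^ C
        ≤ (((A + A) * (A + A)).card : ℝ) := by
  obtain ⟨C, hC, h⟩ := exists_card_pow_le
  have hD : 1 ≤ C * 13 ^ 31 := by nlinarith
  have hD0 : 0 < C * 13 ^ 31 := by linarith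
  refine ⟨(C * 13 ^ 31)⁻¹, 1, inv_pos.2 hD0, one_pos, fun A hA hS => ?_⟩
  have hAne : A.Nonempty := card_pos.1 (by omega)
  have hN : (1 : ℝ) ≤ #(A + A) := by exact_mod_cast card_pos.2 (hAne.add hAne)
  have hL : 1 ≤ Real.logb 2 #A := by
    rw [Real.le_logb_iff_rpow_le one_lt_two (by positivity), Real.rpow_one]
    exact_mod_cast hA
  have hH := harmonicSum_pow_twelve_le hA
  have hH0 : 0 ≤ harmonicSum (#A ^ 12) := sum_nonneg fun _ _ => by positivity
  have h := h A hA hS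
  set N : ℝ := (#(A + A) : ℝ)
  set v : ℝ := (#((A + A) * (A + A)) : ℝ)
  set L : ℝ := Real.logb 2 #A
  have hL0 : 0 < L := by linarith
  have h1 : (N ^ ((1 : ℝ) + 1 / 398)) ^ 102 ≤ N ^ 103 := by
    rw [← Real.rpow_natCast, ← Real.rpow_mul (by linarith), ← Real.rpow_natCast N]
    exact Real.rpow_le_rpow_of_exponent_le hN (by norm_num)
  have h2 : N ^ 103 ≤ (C * 13 ^ 31) * v ^ 102 * L ^ 31 := by
    calc N ^ 103 ≤ C * v ^ 102 * harmonicSum (#A ^ 12) ^ 31 := h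
      _ ≤ C * v ^ 102 * (13 * L) ^ 31 := by gcongr
      _ = _ := by ring
  rw [Real.rpow_one, div_le_iff₀ hL0, inv_mul_le_iff₀ hD0]
  refine le_of_pow_le_pow_left₀ (n := 102) (by norm_num) (by positivity) ?_
  calc (N ^ ((1 : ℝ) + 1 / 398)) ^ 102 ≤ (C * 13 ^ 31) * v ^ 102 * L ^ 31 := h1.trans h2
    _ = (C * 13 ^ 31) ^ 1 * v ^ 102 * L ^ 31 := by rw [pow_one]
    _ ≤ (C * 13 ^ 31) ^ 102 * v ^ 102 * L ^ 102 := by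
      gcongr
      · norm_num
      · norm_num
    _ = _ := by ring
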